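/- arXiv:1611.06958 — 2 statements merged into one kernel-verified Lean document; each statement's English description precedes it below -/
import Mathlib

section
/- For all integers r and s, the coefficient of t^{−r−1} in the Laurent series ξ̄(t)^{−s−1} equals the coefficient of t^{s} in the Laurent series ξ(t)^{r}: [ξ̄(t)^{−s−1}]_{t^{−r−1}} = [ξ(t)^{r}]_{t^{s}}. (First identity of Lemma 5.4.) -/
/-- The "2-typical" power series `∑_{i ≥ 0} a_i t^{2^i}` associated to a
sequence `a : ℕ → R`. -/
noncomputable def twoTypical {R : Type*} [CommRing R] (a : ℕ → R) : PowerSeries R :=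
  PowerSeries.mk fun n => ∑ i ∈ Finset.range (n + 1), if n = 2 ^ i then a i else 0

namespace TwoTypical

open PowerSeries

variable {R : Type*} [CommRing R]

theorem coeff_two_pow (a : ℕ → R) (i : ℕ) : coeff (2 ^ i) (twoTypical a) = a i := by
  rw [twoTypical, coeff_mk, Finset.sum_eq_single i]
  · simp
  · intro j _ hj
    rw [if_neg]
    intro h
    exact hj (Nat.pow_right_injective le_rfl h).symm
  · intro h
    exact absurd (Finset.mem_range.2 (Nat.lt_succ_of_lt Nat.lt_two_pow_self)) h

theorem coeff_of_ne_two_pow (a : ℕ → R) {n : ℕ} (h : ∀ i, n ≠ 2 ^ i) :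
    coeff n (twoTypical a) = 0 := by
  rw [twoTypical, coeff_mk]
  exact Finset.sum_eq_zero fun i _ => if_neg (h i)

theorem constantCoeff_eq_zero (a : ℕ → R) : constantCoeff (twoTypical a) = 0 := by
  rw [← coeff_zero_eq_constantCoeff_apply]
  exact coeff_of_ne_two_pow a fun i => (Nat.two_pow_pos i).ne

theorem hasSubst (a : ℕ → R) : HasSubst (twoTypical a) :=
  HasSubst.of_constantCoeff_zero' (constantCoeff_eq_zero a)

/-- A 2-typical power series with leading coefficient `1` is `X` times a unit. -/
theorem exists_eq_X_mul_unit {a : ℕ → R} (ha : a 0 = 1) :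
    ∃ u : (PowerSeries R)ˣ, twoTypical a = X * (u : PowerSeries R) := by
  obtain ⟨f, hf⟩ := X_dvd_iff.2 (constantCoeff_eq_zero a)
  have h1 : constantCoeff f = 1 := by
    rw [← coeff_zero_eq_constantCoeff_apply, ← coeff_succ_X_mul, ← hf, ← ha]
    exact coeff_two_pow a 0
  have hu : IsUnit f := isUnit_iff_constantCoeff.2 (h1 ▸ isUnit_one)
  exact ⟨hu.unit, hf⟩

section CharTwo

variable [CharP R 2]

theorem coeff_pow_two_pow (f : PowerSeries R) (j n : ℕ) :
    coeff n (f ^ 2 ^ j) = if 2 ^ j ∣ n then coeff (n / 2 ^ j) f ^ 2 ^ j else 0 := by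
  have h : PowerSeries.map (iterateFrobenius R 2 j)
      (PowerSeries.expand (2 ^ j) (pow_ne_zero j two_ne_zero) f) = f ^ 2 ^ j :=
    MvPowerSeries.map_iterateFrobenius_expand 2 two_ne_zero f j
  rw [← h, coeff_map, coeff_expand]
  split_ifs
  · rw [iterateFrobenius_def]
  · exact map_zero _

theorem coeff_sq (f : PowerSeries R) (n : ℕ) :
    coeff n (f ^ 2) = if 2 ∣ n then coeff (n / 2) f ^ 2 else 0 := by
  simpa using coeff_pow_two_pow f 1 n

/-- The residue of `(X / g) ^ (-m - 1)` vanishes for `m ≥ 1`, if `g⁻¹ = u` has no terms of positive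
even degree. -/
theorem coeff_pow_succ_self {u g : PowerSeries R} (hug : u * g = 1)
    (hu : ∀ k, 1 ≤ k → coeff (2 * k) u = 0) (m : ℕ) (hm : 1 ≤ m) :
    coeff m (g ^ (m + 1)) = 0 := by
  induction m using Nat.strong_induction_on with
  | _ m ih =>
  obtain ⟨k, rfl | rfl⟩ := Nat.even_or_odd' m
  · have h : g ^ (2 * k + 1) = (g ^ (k + 1)) ^ 2 * u := by
      calc g ^ (2 * k + 1) = g ^ (2 * k + 1) * (u * g) := by rw [hug, mul_one]
        _ = _ := by ring
    rw [h, coeff_mul, Finset.sum_eq_single (2 * k, 0)]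
    · rw [coeff_sq, if_pos (dvd_mul_right 2 k), Nat.mul_div_cancel_left k two_pos,
        ih k (by omega) (by omega)]
      simp
    · rintro ⟨a, b⟩ hab hne
      rw [Finset.HasAntidiagonal.mem_antidiagonal] at hab
      dsimp only at hab ⊢
      rw [coeff_sq]
      split_ifs with hd
      · obtain ⟨c, rfl⟩ := hd
        obtain rfl | hc := eq_or_ne c k
        · exact absurd (by rw [Prod.mk.injEq]; omega) hne
        · have hb : b = 2 * (k - c) := by omega
          rw [hb, hu _ (by omega), mul_zero]
      · exact zero_mul _
    · intro h
      exact absurd (Finset.HasAntidiagonal.mem_antidiagonal.2 (add_zero _)) h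
  · have h : g ^ (2 * k + 1 + 1) = (g ^ (k + 1)) ^ 2 := by ring
    rw [h, coeff_sq, if_neg (show ¬2 ∣ 2 * k + 1 by omega)]

/-- Invariance of residues under the substitution `X ↦ X * u`, where `u = g⁻¹`. -/
theorem coeff_subst_mul_pow {u g : PowerSeries R} (hug : u * g = 1) (hu0 : constantCoeff u = 1)
    (hu : ∀ k, 1 ≤ k → coeff (2 * k) u = 0) (n : ℕ) (w : PowerSeries R) :
    coeff n (w.subst (X * u) * g ^ (n + 1)) = coeff n w := by
  have hs : HasSubst (X * u) := HasSubst.of_constantCoeff_zero' (by simp)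
  have hg0 : constantCoeff g = 1 := by
    simpa [hu0] using congrArg constantCoeff hug
  have hw (w : PowerSeries R) : w.subst (X * u) =
      X * u * (mk fun p => coeff (p + 1) w).subst (X * u) + C (constantCoeff w) := by
    conv_lhs => rw [eq_X_mul_shift_add_const w]
    rw [subst_add hs, subst_mul hs, subst_X hs, subst_C]
    rfl
  induction n generalizing w with
  | zero =>
    rw [hw]
    simp [hg0]
  | succ m ih =>
    have h : w.subst (X * u) * g ^ (m + 1 + 1) =
        X * ((mk fun p => coeff (p + 1) w).subst (X * u) * g ^ (m + 1)) +
          C (constantCoeff w) * g ^ (m + 1 + 1) := by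
      rw [hw w]
      linear_combination
        X * (mk fun p => coeff (p + 1) w).subst (X * u) * g ^ (m + 1) * hug
    rw [h, map_add, coeff_succ_X_mul, ih, coeff_mk, coeff_C_mul,
      coeff_pow_succ_self hug hu (m + 1) (by omega), mul_zero, add_zero]

/-- The recursive relation between the coefficients says that `twoTypical b` is a left
compositional inverse of `twoTypical a`. -/
theorem subst_eq_X {a b : ℕ → R} (ha : a 0 = 1) (hb : b 0 = 1)
    (hrel : ∀ i : ℕ, 1 ≤ i → ∑ j ∈ Finset.range (i + 1), a (i - j) ^ (2 ^ j) * b j = 0) :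
    (twoTypical b).subst (twoTypical a) = (X : PowerSeries R) := by
  ext n
  have key : coeff n ((twoTypical b).subst (twoTypical a) : PowerSeries R) =
      ∑ j ∈ Finset.range (n + 1), b j * coeff n (twoTypical a ^ 2 ^ j) := by
    rw [coeff_subst' (hasSubst a),
      finsum_eq_sum_of_support_subset (s := (Finset.range (n + 1)).image (2 ^ ·))]
    · rw [Finset.sum_image fun x _ y _ h => Nat.pow_right_injective le_rfl h]
      simp only [coeff_two_pow, smul_eq_mul]
    · intro d hd
      rw [Function.mem_support] at hd
      by_cases h : ∃ j, d = 2 ^ j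
      · obtain ⟨j, rfl⟩ := h
        simp only [Finset.coe_image, Set.mem_image, Finset.mem_coe, Finset.mem_range]
        refine ⟨j, ?_, rfl⟩
        by_contra hj
        apply hd
        have hlt : n < 2 ^ j := lt_of_lt_of_le Nat.lt_two_pow_self
          (Nat.pow_le_pow_right two_pos (by omega))
        rw [coeff_of_lt_order n, smul_zero]
        refine lt_of_lt_of_le (Nat.cast_lt.2 hlt) ?_
        exact le_order_pow_of_constantCoeff_eq_zero _ (constantCoeff_eq_zero a)
      · push Not at h
        rw [coeff_of_ne_two_pow b h, zero_smul] at hd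
        exact absurd rfl hd
  rw [key]
  by_cases h : ∃ i, n = 2 ^ i
  · obtain ⟨i, rfl⟩ := h
    have hsum : ∑ j ∈ Finset.range (2 ^ i + 1), b j * coeff (2 ^ i) (twoTypical a ^ 2 ^ j) =
        ∑ j ∈ Finset.range (i + 1), a (i - j) ^ (2 ^ j) * b j := by
      rw [← Finset.sum_subset (s₁ := Finset.range (i + 1))]
      · refine Finset.sum_congr rfl fun j hj => ?_
        have hji : j ≤ i := Nat.lt_succ_iff.1 (Finset.mem_range.1 hj)
        rw [coeff_pow_two_pow, if_pos (pow_dvd_pow 2 hji), Nat.pow_div hji two_pos,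
          coeff_two_pow, mul_comm]
      · have := (Nat.lt_two_pow_self : i < 2 ^ i)
        exact Finset.range_subset_range.2 (by omega)
      · intro j _ hj
        rw [coeff_pow_two_pow, if_neg, mul_zero]
        rw [Nat.pow_dvd_pow_iff_le_right one_lt_two]
        simpa using hj
    rw [hsum, coeff_X]
    rcases Nat.eq_zero_or_pos i with rfl | hi
    · simp [ha, hb]
    · rw [hrel i hi, if_neg (Nat.one_lt_two_pow hi.ne').ne']
  · push Not at h
    rw [coeff_X, if_neg (by simpa using h 0)]
    refine Finset.sum_eq_zero fun j _ => ?_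
    rw [coeff_pow_two_pow]
    split_ifs with hd
    · obtain ⟨c, rfl⟩ := hd
      rw [Nat.mul_div_cancel_left c (Nat.two_pow_pos j), coeff_of_ne_two_pow, zero_pow, mul_zero]
      · exact (Nat.two_pow_pos j).ne'
      · rintro i rfl
        exact h (j + i) (pow_add 2 j i).symm
    · exact mul_zero _

theorem coeff_zpow_eq_coeff_zpow {a b : ℕ → R} (ha : a 0 = 1) (hb : b 0 = 1)
    (hrel : ∀ i : ℕ, 1 ≤ i → ∑ j ∈ Finset.range (i + 1), a (i - j) ^ (2 ^ j) * b j = 0)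
    {u v : (PowerSeries R)ˣ} (hu : twoTypical a = X * (u : PowerSeries R))
    (hv : twoTypical b = X * (v : PowerSeries R)) (s : ℤ) (n : ℕ) :
    coeff n ((v ^ (-s - 1) : (PowerSeries R)ˣ) : PowerSeries R) =
      coeff n ((u ^ (s - n) : (PowerSeries R)ˣ) : PowerSeries R) := by
  have hcoeff : ∀ k, coeff k (u : PowerSeries R) = coeff (k + 1) (twoTypical a) := fun k => by
    rw [hu, coeff_succ_X_mul]
  have hu0 : constantCoeff (u : PowerSeries R) = 1 := by
    rw [← coeff_zero_eq_constantCoeff_apply, hcoeff, ← ha]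
    exact coeff_two_pow a 0
  have hu_even : ∀ k, 1 ≤ k → coeff (2 * k) (u : PowerSeries R) = 0 := fun k hk => by
    rw [hcoeff]
    refine coeff_of_ne_two_pow a fun i hi => ?_
    cases i with
    | zero => omega
    | succ i => rw [pow_succ] at hi; omega
  have hs : HasSubst (X * (u : PowerSeries R)) := hu ▸ hasSubst a
  let σ : PowerSeries R →* PowerSeries R := (substAlgHom (R := R) hs : PowerSeries R →* _)
  have hσ : ∀ f, σ f = f.subst (X * (u : PowerSeries R)) := fun f => by
    rw [← coe_substAlgHom hs]; rfl
  have huv : Units.map σ v = u⁻¹ := by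
    rw [_root_.eq_inv_iff_mul_eq_one]
    ext1
    have h := subst_eq_X ha hb hrel
    rw [hv, hu, subst_mul hs, subst_X hs, ← hσ] at h
    have h' : X * ((σ v : PowerSeries R) * (u : PowerSeries R)) = X * 1 := by
      rw [mul_one, mul_comm (σ _), ← mul_assoc]
      exact h
    simpa using X_mul_cancel h'
  rw [← coeff_subst_mul_pow (g := (u⁻¹ : (PowerSeries R)ˣ)) u.mul_inv hu0 hu_even n,
    ← hσ, ← Units.coe_map, map_zpow, huv, ← Units.val_pow_eq_pow_val, ← Units.val_mul]
  congr 2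
  rw [← zpow_natCast, inv_zpow', inv_zpow', ← zpow_add]
  congr 1
  push_cast
  ring

end CharTwo

theorem val_zpow_of_val_eq_single {T : (LaurentSeries R)ˣ}
    (hT : (T : LaurentSeries R) = HahnSeries.single 1 1) (n : ℤ) :
    ((T ^ n : (LaurentSeries R)ˣ) : LaurentSeries R) = HahnSeries.single n 1 := by
  let S : Multiplicative ℤ →* LaurentSeries R :=
    { toFun := fun k => HahnSeries.single k.toAdd 1
      map_one' := rfl
      map_mul' := fun x y => by simp [HahnSeries.single_mul_single] }
  have h : T = Units.map S (toUnits (Multiplicative.ofAdd 1)) := Units.ext hT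
  rw [h, ← map_zpow, ← map_zpow, ← ofAdd_zsmul]
  simp [S]

/-- Coefficients of integer powers of a Laurent series of the form `X * u`. -/
theorem coeff_zpow {f : PowerSeries R} {F : (LaurentSeries R)ˣ} {u : (PowerSeries R)ˣ}
    (hF : (F : LaurentSeries R) = HahnSeries.ofPowerSeries ℤ R f)
    (hu : f = X * (u : PowerSeries R)) (k m : ℤ) :
    ((F ^ k : (LaurentSeries R)ˣ) : LaurentSeries R).coeff m =
      (HahnSeries.ofPowerSeries ℤ R ((u ^ k : (PowerSeries R)ˣ) : PowerSeries R)).coeff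
        (m - k) := by
  let T : (LaurentSeries R)ˣ :=
    ⟨HahnSeries.single 1 1, HahnSeries.single (-1) 1, by simp, by simp⟩
  have h : F = T * Units.map (HahnSeries.ofPowerSeries ℤ R : PowerSeries R →* _) u := by
    ext1
    rw [hF, hu, map_mul, HahnSeries.ofPowerSeries_X]
    rfl
  rw [h, mul_zpow, ← map_zpow, Units.val_mul, val_zpow_of_val_eq_single (T := T) rfl,
    HahnSeries.coeff_single_mul, one_mul]
  rfl

end TwoTypical

/-- Over a commutative ring `R` with `2 = 0`, with
`ξ(t) = ∑ ξ_i t^{2^i}` and `ξ̄(t) = ∑ ξ̄_i t^{2^i}` (ξ_0 = ξ̄_0 = 1,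
`∑_{j} ξ_{i−j}^{2^j} ξ̄_j = 0` for `i ≥ 1`), viewed as units `U`, `V` of the
ring of formal Laurent series `R((t))`, one has, for all integers `r, s`:
`[ξ̄(t)^{−s−1}]_{t^{−r−1}} = [ξ(t)^{r}]_{t^{s}}`. -/
theorem coeff_xibar_zpow_eq_coeff_xi_zpow {R : Type*} [CommRing R] (h2 : (2 : R) = 0)
    (xi xibar : ℕ → R) (hxi0 : xi 0 = 1) (hxibar0 : xibar 0 = 1)
    (hrel : ∀ i : ℕ, 1 ≤ i →
      ∑ j ∈ Finset.range (i + 1), xi (i - j) ^ (2 ^ j) * xibar j = 0)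
    (U V : (LaurentSeries R)ˣ)
    (hU : (U : LaurentSeries R) = HahnSeries.ofPowerSeries ℤ R (twoTypical xi))
    (hV : (V : LaurentSeries R) = HahnSeries.ofPowerSeries ℤ R (twoTypical xibar)) :
    ∀ r s : ℤ,
      ((V ^ (-s - 1) : (LaurentSeries R)ˣ) : LaurentSeries R).coeff (-r - 1) =
        ((U ^ r : (LaurentSeries R)ˣ) : LaurentSeries R).coeff s := by
  intro r s
  nontriviality R
  have : CharP R 2 := CharTwo.of_one_ne_zero_of_two_eq_zero one_ne_zero h2
  obtain ⟨u, hu⟩ := TwoTypical.exists_eq_X_mul_unit hxi0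
  obtain ⟨v, hv⟩ := TwoTypical.exists_eq_X_mul_unit hxibar0
  rw [TwoTypical.coeff_zpow hU hu, TwoTypical.coeff_zpow hV hv,
    show -r - 1 - (-s - 1) = s - r by ring, PowerSeries.coeff_coe, PowerSeries.coeff_coe]
  split_ifs with h
  · rfl
  · rw [TwoTypical.coeff_zpow_eq_coeff_zpow hxi0 hxibar0 hrel hu hv,
      show s - ((s - r).natAbs : ℤ) = r by omega]
end

section
/- For all integers r and s, the coefficient of t^{−r−1} in the Laurent series τ̄(t)·ξ̄(t)^{−s−1} equals the coefficient of t^{s} in the Laurent series ξ(t)^{r}·τ(t): [τ̄(t)·ξ̄(t)^{−s−1}]_{t^{−r−1}} = [ξ(t)^{r}·τ(t)]_{t^{s}}. (Second identity of Lemma 5.4.) -/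
section TwoTypical

variable {R : Type*} [CommRing R]

theorem coeff_twoTypical_two_pow (a : ℕ → R) (i : ℕ) :
    (twoTypical a).coeff (2 ^ i) = a i := by
  rw [twoTypical, PowerSeries.coeff_mk, Finset.sum_eq_single i]
  · simp
  · intro j _ hj
    rw [if_neg fun h => hj (Nat.pow_right_injective le_rfl h).symm]
  · intro h
    exact absurd (Finset.mem_range.2 (Nat.lt_succ_of_lt Nat.lt_two_pow_self)) h

theorem coeff_twoTypical_of_ne (a : ℕ → R) {n : ℕ} (hn : ∀ i, n ≠ 2 ^ i) :
    (twoTypical a).coeff n = 0 := by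
  rw [twoTypical, PowerSeries.coeff_mk]
  exact Finset.sum_eq_zero fun i _ => if_neg (hn i)

theorem constantCoeff_twoTypical (a : ℕ → R) :
    PowerSeries.constantCoeff (twoTypical a) = 0 := by
  rw [← PowerSeries.coeff_zero_eq_constantCoeff_apply]
  exact coeff_twoTypical_of_ne a fun i => (pow_pos two_pos i).ne

theorem twoTypical_eq_X {a : ℕ → R} (h0 : a 0 = 1) (h : ∀ i, 1 ≤ i → a i = 0) :
    twoTypical a = PowerSeries.X := by
  ext n
  rw [PowerSeries.coeff_X]
  by_cases hn : ∃ i, n = 2 ^ i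
  · obtain ⟨i, rfl⟩ := hn
    rw [coeff_twoTypical_two_pow]
    rcases Nat.eq_zero_or_pos i with rfl | hi
    · simp [h0]
    · rw [h i hi, if_neg (Nat.one_lt_two_pow hi.ne').ne']
  · push Not at hn
    rw [coeff_twoTypical_of_ne a hn, if_neg (by simpa using hn 0)]

theorem PowerSeries.coeff_sq_of_charTwo [CharP R 2] (f : PowerSeries R) (n : ℕ) :
    (f ^ 2).coeff n = if 2 ∣ n then f.coeff (n / 2) ^ 2 else 0 := by
  have h : (f.expand 2 two_ne_zero).map (frobenius R 2) = f ^ 2 :=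
    MvPowerSeries.map_frobenius_expand 2 two_ne_zero
  rw [← h, PowerSeries.coeff_map, PowerSeries.coeff_expand]
  split_ifs <;> simp [frobenius_def]

theorem twoTypical_sq [CharP R 2] (a : ℕ → R) :
    twoTypical a ^ 2 = twoTypical fun k => if 1 ≤ k then a (k - 1) ^ 2 else 0 := by
  ext n
  rw [PowerSeries.coeff_sq_of_charTwo]
  by_cases hn : ∃ i, n = 2 ^ i
  · obtain ⟨i, rfl⟩ := hn
    rw [coeff_twoTypical_two_pow]
    rcases i with _ | i
    · simp
    · simp [pow_succ, coeff_twoTypical_two_pow]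
  · push Not at hn
    rw [coeff_twoTypical_of_ne _ hn]
    split_ifs with h
    · obtain ⟨m, rfl⟩ := h
      rw [Nat.mul_div_cancel_left _ two_pos, coeff_twoTypical_of_ne, zero_pow two_ne_zero]
      intro i hi
      exact hn (i + 1) (by rw [hi, pow_succ'])
    · rfl

theorem twoTypical_pow_two_pow [CharP R 2] (a : ℕ → R) (j : ℕ) :
    twoTypical a ^ 2 ^ j =
      twoTypical fun k => if j ≤ k then a (k - j) ^ 2 ^ j else 0 := by
  induction j with
  | zero => simp
  | succ j ih =>
    rw [pow_succ, pow_mul, ih, twoTypical_sq]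
    congr 1
    funext k
    rcases k with _ | k
    · simp
    · simp only [Nat.le_add_left, if_true, Nat.add_sub_cancel, Nat.add_le_add_iff_right,
        Nat.add_sub_add_right]
      split_ifs
      · rw [← pow_mul]
      · simp

theorem hasSubst_twoTypical (a : ℕ → R) : PowerSeries.HasSubst (twoTypical a) :=
  PowerSeries.HasSubst.of_constantCoeff_zero' (constantCoeff_twoTypical a)

theorem subst_twoTypical [CharP R 2] (x a : ℕ → R) :
    (twoTypical a).subst (twoTypical x) =
      twoTypical fun i => ∑ j ∈ Finset.range (i + 1), x (i - j) ^ 2 ^ j * a j := by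
  ext n
  have key : (PowerSeries.coeff n) ((twoTypical a).subst (twoTypical x)) =
      ∑ j ∈ Finset.range (n + 1), a j * (twoTypical x ^ 2 ^ j).coeff n := by
    rw [PowerSeries.coeff_subst' (hasSubst_twoTypical x),
      finsum_eq_sum_of_support_subset (s := (Finset.range (n + 1)).image (2 ^ ·)),
      Finset.sum_image (Nat.pow_right_injective le_rfl).injOn]
    · simp [coeff_twoTypical_two_pow]
    · intro d hd
      rw [Function.mem_support] at hd
      by_cases h : ∃ i, d = 2 ^ i
      · obtain ⟨i, rfl⟩ := h
        simp only [Finset.coe_image, Finset.coe_range, Set.mem_image, Set.mem_Iio]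
        refine ⟨i, ?_, rfl⟩
        by_contra hi
        apply hd
        rw [PowerSeries.coeff_of_lt_order (φ := twoTypical x ^ 2 ^ i), smul_zero]
        have h1 : n < 2 ^ i := lt_trans (by omega) Nat.lt_two_pow_self
        exact lt_of_lt_of_le (by exact_mod_cast h1)
          (PowerSeries.le_order_pow_of_constantCoeff_eq_zero _ (constantCoeff_twoTypical x))
      · push Not at h
        exact absurd (by rw [coeff_twoTypical_of_ne a h, zero_smul]) hd
  rw [key]
  simp only [twoTypical_pow_two_pow]
  by_cases hn : ∃ i, n = 2 ^ i
  · obtain ⟨i, rfl⟩ := hn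
    simp only [coeff_twoTypical_two_pow]
    rw [← Finset.sum_subset (s₁ := Finset.range (i + 1))]
    · refine Finset.sum_congr rfl fun j hj => ?_
      rw [if_pos (Nat.lt_succ_iff.1 (Finset.mem_range.1 hj)), mul_comm]
    · exact Finset.range_mono (by have := @Nat.lt_two_pow_self i; omega)
    · intro j _ hj
      rw [if_neg (by simpa [Nat.lt_succ_iff] using hj), mul_zero]
  · push Not at hn
    simp [coeff_twoTypical_of_ne _ hn]

end TwoTypical

namespace LaurentSeries

open HahnSeries

variable {R : Type*} [CommRing R]

theorem exists_eq_single_neg_mul (F : LaurentSeries R) :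
    ∃ (N : ℕ) (f : PowerSeries R), F = single (-N : ℤ) 1 * ofPowerSeries ℤ R f := by
  obtain ⟨⟨f, ⟨_, N, rfl⟩⟩, h⟩ :=
    IsLocalization.surj (Submonoid.powers (PowerSeries.X : PowerSeries R)) F
  refine ⟨N, f, ?_⟩
  simp only [coe_algebraMap, ofPowerSeries_X_pow] at h
  rw [← h, mul_comm, mul_assoc, single_mul_single]
  simp

theorem coeff_sq_of_charTwo [CharP R 2] (F : LaurentSeries R) (n : ℤ) :
    (F ^ 2).coeff n = if 2 ∣ n then F.coeff (n / 2) ^ 2 else 0 := by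
  obtain ⟨N, f, rfl⟩ := exists_eq_single_neg_mul F
  rw [mul_pow, single_pow, ← map_pow]
  simp only [coeff_single_mul, one_pow, one_mul, PowerSeries.coeff_coe, PowerSeries.coeff_sq_of_charTwo]
  by_cases hn : 2 ∣ n
  · obtain ⟨m, rfl⟩ := hn
    by_cases hm : m + N < 0
    · rw [if_pos (by simp; omega), if_pos (by simp), if_pos (by omega)]
      simp
    · rw [if_neg (by simp; omega), if_pos (by simp; omega), if_pos (by simp), if_neg (by omega)]
      congr 3
      simp
      omega
  · rw [if_neg hn, if_neg (c := 2 ∣ _) (by simp; omega)]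
    simp

theorem coeff_mul_of_odd {F G : LaurentSeries R} (hF : ∀ n, Odd n → F.coeff n = 0)
    (hG : ∀ n, Odd n → G.coeff n = 0) {n : ℤ} (hn : Odd n) : (F * G).coeff n = 0 := by
  rw [coeff_mul]
  refine Finset.sum_eq_zero fun ij hij => ?_
  rw [Finset.mem_antidiagonal] at hij
  rcases Int.even_or_odd ij.1 with h | h
  · rw [hG ij.2 ?_, mul_zero]
    rw [← hij.2.2] at hn
    exact (Int.odd_add'.1 hn).2 h
  · rw [hF _ h, zero_mul]

/-- The unit `t` of the ring of Laurent series. -/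
noncomputable def unitX (R : Type*) [CommRing R] : (LaurentSeries R)ˣ where
  val := single 1 1
  inv := single (-1) 1
  val_inv := by simp
  inv_val := by simp

theorem coe_unitX_zpow (n : ℤ) :
    ((unitX R ^ n : (LaurentSeries R)ˣ) : LaurentSeries R) = single n 1 := by
  induction n using Int.induction_on with
  | zero => simp
  | succ n ih => rw [zpow_add_one, Units.val_mul, ih]; simp [unitX]
  | pred n ih =>
    rw [zpow_sub_one, Units.val_mul, ih]
    simp [unitX, Units.inv_mk, sub_eq_add_neg]

theorem coeff_neg_one_inv {U : (LaurentSeries R)ˣ} {f : PowerSeries R}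
    (hU : (U : LaurentSeries R) = ofPowerSeries ℤ R f)
    (h0 : PowerSeries.constantCoeff f = 0) (h1 : f.coeff 1 = 1) :
    ((U⁻¹ : (LaurentSeries R)ˣ) : LaurentSeries R).coeff (-1) = 1 := by
  obtain ⟨g, rfl⟩ := PowerSeries.X_dvd_iff.2 h0
  have hg : PowerSeries.constantCoeff g = 1 := by
    rw [← h1, ← zero_add 1, PowerSeries.coeff_succ_X_mul,
      PowerSeries.coeff_zero_eq_constantCoeff_apply]
  have hgh := PowerSeries.mul_invOfUnit g 1 (by simpa using hg)
  have hinv : ((U⁻¹ : (LaurentSeries R)ˣ) : LaurentSeries R) =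
      single (-1) 1 * ofPowerSeries ℤ R (PowerSeries.invOfUnit g 1) := by
    refine Units.inv_eq_of_mul_eq_one_right ?_
    rw [hU, map_mul, ofPowerSeries_X, mul_mul_mul_comm, single_mul_single, ← map_mul, hgh]
    simp
  rw [hinv, coeff_single_mul]
  simp [PowerSeries.coeff_coe]

theorem coeff_neg_one_zpow_twoTypical [CharP R 2] {x : ℕ → R} (hx : x 0 = 1)
    {U : (LaurentSeries R)ˣ} (hU : (U : LaurentSeries R) = ofPowerSeries ℤ R (twoTypical x))
    (n : ℤ) :
    ((U ^ n : (LaurentSeries R)ˣ) : LaurentSeries R).coeff (-1) = if n = -1 then 1 else 0 := by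
  induction hk : n.natAbs using Nat.strong_induction_on generalizing n with
  | _ k ih =>
    subst hk
    by_cases hn1 : n = -1
    · subst hn1
      rw [if_pos rfl, zpow_neg_one]
      refine coeff_neg_one_inv hU (constantCoeff_twoTypical x) ?_
      simpa [hx] using coeff_twoTypical_two_pow x 0
    rw [if_neg hn1]
    rcases Int.even_or_odd' n with ⟨m, rfl | rfl⟩
    · rw [mul_comm, zpow_mul, zpow_ofNat, Units.val_pow_eq_pow_val, coeff_sq_of_charTwo,
        if_neg (by decide)]
    · have hodd : ∀ i, Odd i → (((U ^ m : (LaurentSeries R)ˣ) : LaurentSeries R) ^ 2).coeff i = 0 :=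
        fun i hi => by
          rw [coeff_sq_of_charTwo, if_neg (by rwa [← even_iff_two_dvd, Int.not_even_iff_odd])]
      have hodd' : ∀ i, Odd i → ((U : LaurentSeries R) - single 1 1).coeff i = 0 := fun i hi => by
        rw [hU, coeff_sub, PowerSeries.coeff_coe, coeff_single]
        rcases lt_or_ge i 0 with h | h
        · rw [if_pos h, if_neg (by omega), sub_zero]
        lift i to ℕ using h
        rw [if_neg (by omega), Int.natAbs_natCast]
        by_cases hi1 : i = 1
        · subst hi1
          simpa [hx, sub_eq_zero] using coeff_twoTypical_two_pow x 0
        · rw [if_neg (by exact_mod_cast hi1), coeff_twoTypical_of_ne, sub_zero]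
          rintro (_ | j) rfl
          · exact hi1 rfl
          · exact absurd hi (by simp [pow_succ])
      have hsplit : ((U ^ (2 * m + 1) : (LaurentSeries R)ˣ) : LaurentSeries R) =
          ((U ^ m : (LaurentSeries R)ˣ) : LaurentSeries R) ^ 2 * ((U : LaurentSeries R) - single 1 1) +
          ((U ^ m : (LaurentSeries R)ˣ) : LaurentSeries R) ^ 2 * single 1 1 := by
        rw [← mul_add, sub_add_cancel, zpow_add_one, mul_comm 2 m, zpow_mul, zpow_ofNat,
          Units.val_mul, Units.val_pow_eq_pow_val]
      rw [hsplit, coeff_add, coeff_mul_of_odd hodd hodd' (by decide), coeff_mul_single,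
        coeff_sq_of_charTwo]
      have := ih m.natAbs (by omega) m rfl
      rw [if_neg (by omega)] at this
      norm_num [this]

/-- Substitution of a power series `f` that is invertible as a Laurent series and has no constant
term, extended from power series to Laurent series. -/
theorem exists_subst_ringHom {U : (LaurentSeries R)ˣ} {f : PowerSeries R}
    (hU : (U : LaurentSeries R) = ofPowerSeries ℤ R f) (hf : PowerSeries.HasSubst f) :
    ∃ φ : LaurentSeries R →+* LaurentSeries R,
      ∀ g : PowerSeries R, φ (ofPowerSeries ℤ R g) = ofPowerSeries ℤ R (g.subst f) := by
  let ψ : PowerSeries R →+* LaurentSeries R :=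
    (ofPowerSeries ℤ R).comp (PowerSeries.substAlgHom (R := R) hf).toRingHom
  have hψ : ∀ g, ψ g = ofPowerSeries ℤ R (g.subst f) := fun g => by
    simp [ψ, PowerSeries.coe_substAlgHom]
  have hX : IsUnit (ψ PowerSeries.X) := by
    rw [hψ, PowerSeries.subst_X hf]
    exact hU ▸ U.isUnit
  have : IsLocalization.Away (PowerSeries.X : PowerSeries R) (LaurentSeries R) :=
    of_powerSeries_localization
  refine ⟨IsLocalization.Away.lift (PowerSeries.X : PowerSeries R) hX, fun g => ?_⟩
  rw [← hψ, ← coe_algebraMap]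
  exact IsLocalization.Away.lift_eq _ hX g

theorem coeff_neg_one_subst_twoTypical [CharP R 2] {x : ℕ → R} (hx : x 0 = 1)
    {U : (LaurentSeries R)ˣ} (hU : (U : LaurentSeries R) = ofPowerSeries ℤ R (twoTypical x))
    {φ : LaurentSeries R →+* LaurentSeries R}
    (hφ : ∀ g : PowerSeries R,
      φ (ofPowerSeries ℤ R g) = ofPowerSeries ℤ R (g.subst (twoTypical x)))
    (hφX : Units.map (φ : LaurentSeries R →* LaurentSeries R) (unitX R) = U)
    (F : LaurentSeries R) : (φ F).coeff (-1) = F.coeff (-1) := by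
  obtain ⟨N, f, rfl⟩ := exists_eq_single_neg_mul F
  have hpow : ∀ n : ℤ, φ (single n 1) = ((U ^ n : (LaurentSeries R)ˣ) : LaurentSeries R) :=
    fun n => by rw [← coe_unitX_zpow, ← hφX, ← map_zpow, Units.coe_map]; rfl
  induction N generalizing f with
  | zero =>
    simp [hφ, PowerSeries.coeff_coe]
  | succ N ih =>
    have hC : φ (ofPowerSeries ℤ R (PowerSeries.C (PowerSeries.constantCoeff f))) =
        C (PowerSeries.constantCoeff f) := by
      rw [hφ, PowerSeries.subst_C]
      exact ofPowerSeries_C _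
    obtain ⟨g, hg⟩ : PowerSeries.X ∣ f - PowerSeries.C (PowerSeries.constantCoeff f) :=
      PowerSeries.X_dvd_iff.2 (by simp)
    have hf := sub_eq_iff_eq_add'.1 hg
    have hF : (single (-(N + 1 : ℕ) : ℤ) 1 : LaurentSeries R) * ofPowerSeries ℤ R f =
        single (-(N + 1 : ℕ) : ℤ) 1 *
          ofPowerSeries ℤ R (PowerSeries.C (PowerSeries.constantCoeff f)) +
        single (-N : ℤ) 1 * ofPowerSeries ℤ R g := by
      conv_lhs => rw [hf]
      rw [map_add, mul_add, map_mul, ← mul_assoc, ofPowerSeries_X, single_mul_single]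
      simp
    rw [hF, map_add, coeff_add, coeff_add, ih, map_mul, hC, hpow, ofPowerSeries_C, mul_comm,
      mul_comm _ (C _)]
    simp only [C_apply, coeff_single_zero_mul, coeff_neg_one_zpow_twoTypical hx hU, coeff_single]
    split_ifs <;> first | rfl | omega

end LaurentSeries

/-- Over a commutative ring `R` with `2 = 0`, with
`ξ(t) = ∑ ξ_i t^{2^i}`, `ξ̄(t) = ∑ ξ̄_i t^{2^i}` (ξ_0 = ξ̄_0 = 1,
`∑_j ξ_{i−j}^{2^j} ξ̄_j = 0` for `i ≥ 1`) viewed as units `U`, `V` of `R((t))`,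
and `τ(t) = ∑ τ_i t^{2^i}`, `τ̄(t) = ∑ τ̄_i t^{2^i}` with
`τ_i + ∑_j ξ_{i−j}^{2^j} τ̄_j = 0` for all `i ≥ 0`, one has, for all integers
`r, s`: `[τ̄(t)·ξ̄(t)^{−s−1}]_{t^{−r−1}} = [ξ(t)^{r}·τ(t)]_{t^{s}}`. -/
theorem coeff_taubar_xibar_zpow_eq_coeff_xi_zpow_tau {R : Type*} [CommRing R]
    (h2 : (2 : R) = 0)
    (xi xibar : ℕ → R) (hxi0 : xi 0 = 1) (hxibar0 : xibar 0 = 1)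
    (hrel : ∀ i : ℕ, 1 ≤ i →
      ∑ j ∈ Finset.range (i + 1), xi (i - j) ^ (2 ^ j) * xibar j = 0)
    (tau taubar : ℕ → R)
    (htrel : ∀ i : ℕ,
      tau i + ∑ j ∈ Finset.range (i + 1), xi (i - j) ^ (2 ^ j) * taubar j = 0)
    (U V : (LaurentSeries R)ˣ)
    (hU : (U : LaurentSeries R) = HahnSeries.ofPowerSeries ℤ R (twoTypical xi))
    (hV : (V : LaurentSeries R) = HahnSeries.ofPowerSeries ℤ R (twoTypical xibar)) :
    ∀ r s : ℤ,
      (HahnSeries.ofPowerSeries ℤ R (twoTypical taubar) *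
          ((V ^ (-s - 1) : (LaurentSeries R)ˣ) : LaurentSeries R)).coeff (-r - 1) =
        (((U ^ r : (LaurentSeries R)ˣ) : LaurentSeries R) *
          HahnSeries.ofPowerSeries ℤ R (twoTypical tau)).coeff s := by
  intro r s
  rcases subsingleton_or_nontrivial R with hR | hR
  · exact Subsingleton.elim _ _
  have : CharP R 2 := CharTwo.of_one_ne_zero_of_two_eq_zero one_ne_zero h2
  obtain ⟨φ, hφ⟩ := LaurentSeries.exists_subst_ringHom hU (hasSubst_twoTypical xi)
  have hφX : Units.map (φ : LaurentSeries R →* LaurentSeries R) (LaurentSeries.unitX R) = U := by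
    ext1
    have h := hφ PowerSeries.X
    rw [PowerSeries.subst_X (hasSubst_twoTypical xi), ← hU, HahnSeries.ofPowerSeries_X] at h
    exact h
  have hφV : Units.map (φ : LaurentSeries R →* LaurentSeries R) V = LaurentSeries.unitX R := by
    ext1
    have h := hφ (twoTypical xibar)
    rw [← hV, subst_twoTypical, twoTypical_eq_X (by simp [hxi0, hxibar0]) hrel,
      HahnSeries.ofPowerSeries_X] at h
    exact h
  have hφtau : φ (HahnSeries.ofPowerSeries ℤ R (twoTypical taubar)) =
      HahnSeries.ofPowerSeries ℤ R (twoTypical tau) := by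
    rw [hφ, subst_twoTypical]
    congr 2
    funext i
    exact (CharTwo.add_eq_zero.1 (htrel i)).symm
  have hzpow : ∀ (W : (LaurentSeries R)ˣ) (n : ℤ),
      φ ((W ^ n : (LaurentSeries R)ˣ) : LaurentSeries R) =
        ((Units.map (φ : LaurentSeries R →* LaurentSeries R) W ^ n : (LaurentSeries R)ˣ) :
          LaurentSeries R) := fun W n => by
    rw [← map_zpow, Units.coe_map]; rfl
  have hres := LaurentSeries.coeff_neg_one_subst_twoTypical hxi0 hU hφ hφX
    (HahnSeries.ofPowerSeries ℤ R (twoTypical taubar) *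
      ((V ^ (-s - 1) : (LaurentSeries R)ˣ) : LaurentSeries R) *
      ((LaurentSeries.unitX R ^ r : (LaurentSeries R)ˣ) : LaurentSeries R))
  rw [map_mul, map_mul, hφtau, hzpow, hzpow, hφV, hφX, LaurentSeries.coe_unitX_zpow,
    LaurentSeries.coe_unitX_zpow, HahnSeries.coeff_mul_single, mul_one, mul_right_comm,
    HahnSeries.coeff_mul_single, mul_one, mul_comm (HahnSeries.ofPowerSeries ℤ R _)] at hres
  rw [show -r - 1 = -1 - r by ring, ← hres]
  congr 1
  ring
end
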